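/- Let a ≤ b be reals, n ≥ 1, and restrict all datasets to [a,b]^n. Define Ū^ℓ_Var(x) = Var(x) + ℓ·(b−a)²/n for ℓ ∈ ℕ. Then Ū^ℓ_Var are valid approximate upper sensitivity bounding functions for the variance: for every ℓ ∈ ℕ, every x ∈ [a,b]^n, and every neighboring x' ∈ [a,b]^n, (i) Ū^ℓ_Var(x) ≥ sup{ Var(z) : z ∈ [a,b]^n, d_ham(x,z) ≤ ℓ }, and (ii) Ū^ℓ_Var(x) ≤ Ū^{ℓ+1}_Var(x'). -/

import Mathlib

open scoped Classical

/-- Hamming distance between two datasets. -/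
noncomputable def hdist {n : ℕ} {X : Type*} (x x' : Fin n → X) : ℕ :=
  (Finset.univ.filter fun i => x i ≠ x' i).card

/-- The mean of the coordinates of `x` indexed by `s`. -/
noncomputable def meanOn {n : ℕ} (s : Finset (Fin n)) (x : Fin n → ℝ) : ℝ :=
  (∑ i ∈ s, x i) / s.card

/-- The variance of the tuple of coordinates of `x` indexed by `s`. -/
noncomputable def varOn {n : ℕ} (s : Finset (Fin n)) (x : Fin n → ℝ) : ℝ :=
  (∑ i ∈ s, (x i - meanOn s x) ^ 2) / s.card

/-- The variance of a dataset `x ∈ ℝ^n`. -/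
noncomputable def Var {n : ℕ} (x : Fin n → ℝ) : ℝ :=
  varOn Finset.univ x

/-- The approximate upper sensitivity bounding function for the variance,
`Ū^ℓ_Var(x) = Var(x) + ℓ·(b−a)²/n`. -/
noncomputable def UbarVar {n : ℕ} (a b : ℝ) (ℓ : ℕ) (x : Fin n → ℝ) : ℝ :=
  Var x + ℓ * (b - a) ^ 2 / n

theorem hdist_comm {n : ℕ} {X : Type*} (x z : Fin n → X) : hdist x z = hdist z x := by
  simp only [hdist, ne_comm]

theorem meanOn_mem_Icc {n : ℕ} {s : Finset (Fin n)} (hs : s.Nonempty) {a b : ℝ}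
    {x : Fin n → ℝ} (hx : ∀ i ∈ s, x i ∈ Set.Icc a b) : meanOn s x ∈ Set.Icc a b := by
  have hc : (0 : ℝ) < s.card := by exact_mod_cast hs.card_pos
  rw [meanOn, Set.mem_Icc, le_div_iff₀ hc, div_le_iff₀ hc]
  constructor
  · simpa [mul_comm] using s.card_nsmul_le_sum x a fun i hi => (hx i hi).1
  · simpa [mul_comm] using s.sum_le_card_nsmul x b fun i hi => (hx i hi).2

/-- The mean minimizes the sum of squared deviations. -/
theorem sum_sq_sub_meanOn_le {n : ℕ} (s : Finset (Fin n)) (x : Fin n → ℝ) (c : ℝ) :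
    ∑ i ∈ s, (x i - meanOn s x) ^ 2 ≤ ∑ i ∈ s, (x i - c) ^ 2 := by
  rcases s.eq_empty_or_nonempty with rfl | hs
  · simp
  have hc : (s.card : ℝ) ≠ 0 := by exact_mod_cast hs.card_pos.ne'
  have hm : s.card * meanOn s x = ∑ i ∈ s, x i := by
    rw [meanOn]; field_simp
  have expand (d : ℝ) : ∑ i ∈ s, (x i - d) ^ 2 =
      ∑ i ∈ s, x i ^ 2 - 2 * d * ∑ i ∈ s, x i + s.card * d ^ 2 := by
    simp only [sub_sq, Finset.sum_add_distrib, Finset.sum_sub_distrib, Finset.sum_const,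
      nsmul_eq_mul, Finset.mul_sum]
    congr 2
    exact Finset.sum_congr rfl fun i _ => by ring
  rw [expand, expand, ← hm]
  nlinarith [mul_nonneg (Nat.cast_nonneg (α := ℝ) s.card) (sq_nonneg (meanOn s x - c))]

theorem Var_le_add_hdist {n : ℕ} (hn : 1 ≤ n) {a b : ℝ} {x z : Fin n → ℝ}
    (hx : ∀ i, x i ∈ Set.Icc a b) (hz : ∀ i, z i ∈ Set.Icc a b) :
    Var z ≤ Var x + hdist x z * (b - a) ^ 2 / n := by
  have : NeZero n := ⟨by omega⟩
  obtain ⟨hma, hmb⟩ := meanOn_mem_Icc (s := Finset.univ) Finset.univ_nonempty fun i _ => hx i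
  set m := meanOn Finset.univ x with hm
  have key : ∑ i, (z i - m) ^ 2 ≤ ∑ i, (x i - m) ^ 2 + hdist x z * (b - a) ^ 2 := by
    rw [hdist, Finset.card_filter, Nat.cast_sum, Finset.sum_mul, ← Finset.sum_add_distrib]
    refine Finset.sum_le_sum fun i _ => ?_
    by_cases h : x i = z i
    · simp [h]
    · obtain ⟨hza, hzb⟩ := hz i
      have : (z i - m) ^ 2 ≤ (b - a) ^ 2 := sq_le_sq' (by linarith) (by linarith)
      simp only [ne_eq, h, not_false_eq_true, if_true, Nat.cast_one, one_mul]
      linarith [sq_nonneg (x i - m)]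
  simp only [Var, varOn, Finset.card_univ, Fintype.card_fin, ← hm]
  rw [← add_div]
  gcongr
  exact (sum_sq_sub_meanOn_le _ z m).trans key

theorem Var_le_add_of_hdist_le {n : ℕ} (hn : 1 ≤ n) {a b : ℝ} {x z : Fin n → ℝ}
    (hx : ∀ i, x i ∈ Set.Icc a b) (hz : ∀ i, z i ∈ Set.Icc a b) {k : ℕ} (h : hdist x z ≤ k) :
    Var z ≤ Var x + k * (b - a) ^ 2 / n :=
  (Var_le_add_hdist hn hx hz).trans (by gcongr)

/-- `Ū^ℓ_Var` are valid approximate upper sensitivity bounding functions for the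
variance on `[a,b]^n`. -/
theorem stmt10 {n : ℕ} (hn : 1 ≤ n) (a b : ℝ) (hab : a ≤ b) (ℓ : ℕ)
    (x x' : Fin n → ℝ)
    (hx : ∀ i, x i ∈ Set.Icc a b) (hx' : ∀ i, x' i ∈ Set.Icc a b)
    (hnb : hdist x x' ≤ 1) :
    sSup (Var '' {z : Fin n → ℝ | (∀ i, z i ∈ Set.Icc a b) ∧ hdist x z ≤ ℓ})
        ≤ UbarVar a b ℓ x ∧
      UbarVar a b ℓ x ≤ UbarVar a b (ℓ + 1) x' := by
  constructor
  · refine csSup_le ⟨Var x, x, ⟨hx, by simp [hdist]⟩, rfl⟩ ?_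
    rintro _ ⟨z, ⟨hz, hxz⟩, rfl⟩
    exact Var_le_add_of_hdist_le hn hx hz hxz
  · have h := Var_le_add_of_hdist_le hn hx' hx (hdist_comm x x' ▸ hnb)
    simp only [UbarVar]
    push_cast at h ⊢
    rw [add_mul, add_div]
    linarith
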